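/- Let σ > 0 and let f : ℝ → ℝ be a Schwartz function. For n ∈ ℕ define the Hermite DSC kernel δ_{σ,n}(x) = (1/(σ√(2π))) · e^{-x²/(2σ²)} · Σ_{k=0}^{n} (-1/4)^k (1/k!) H_{2k}(x/(√2 σ)), where H_m denotes the physicists' Hermite polynomials. Then lim_{n → ∞} ∫_ℝ δ_{σ,n}(x) f(x) dx = f(0); that is, the Hermite kernel recovers the Dirac delta distribution in the limit n → ∞. -/

import Mathlib

open Real Filter

/-- The physicists' Hermite polynomials, as real functions:
`H 0 x = 1`, `H 1 x = 2x`, `H (m+2) x = 2x H (m+1) x - 2(m+1) H m x`. -/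
noncomputable def physHermite : ℕ → ℝ → ℝ
  | 0 => fun _ => 1
  | 1 => fun x => 2 * x
  | (m + 2) => fun x => 2 * x * physHermite (m + 1) x - 2 * (m + 1) * physHermite m x

/-- The Hermite DSC kernel of order `n` with Gaussian parameter `σ`. -/
noncomputable def hermiteDSCKernel (σ : ℝ) (n : ℕ) (x : ℝ) : ℝ :=
  (1 / (σ * Real.sqrt (2 * π))) * Real.exp (-x ^ 2 / (2 * σ ^ 2)) *
    ∑ k ∈ Finset.range (n + 1),
      (-(1 / 4) : ℝ) ^ k * (1 / (k.factorial : ℝ))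
        * physHermite (2 * k) (x / (Real.sqrt 2 * σ))

open MeasureTheory FourierTransform

lemma physHermite_succ (m : ℕ) (x : ℝ) :
    physHermite (m + 1) x = 2 * x * physHermite m x - 2 * m * physHermite (m - 1) x := by
  cases m with
  | zero => simp [physHermite]
  | succ m => simp [physHermite]

lemma hasDerivAt_physHermite (m : ℕ) (x : ℝ) :
    HasDerivAt (physHermite m) (2 * m * physHermite (m - 1) x) x := by
  induction m using Nat.twoStepInduction with
  | zero => simpa [physHermite] using hasDerivAt_const x (1 : ℝ)
  | one => simpa [physHermite] using (hasDerivAt_id x).const_mul (2 : ℝ)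
  | more m ih₀ ih₁ =>
    have h := (((hasDerivAt_id x).const_mul (2 : ℝ)).mul ih₁).sub
      (ih₀.const_mul (2 * ((m : ℝ) + 1)))
    refine h.congr_deriv ?_
    have := physHermite_succ m x
    simp only [id, Nat.add_sub_cancel, show m + 2 - 1 = m + 1 by omega]
    push_cast
    linear_combination (-2 * ((m : ℝ) + 1)) * this

/-- The Rodrigues formula for the rescaled Gaussian. -/
lemma iteratedDeriv_gaussian {σ : ℝ} (hσ : 0 < σ) (m : ℕ) :
    iteratedDeriv m (fun x : ℝ => ((Real.exp (-x ^ 2 / (2 * σ ^ 2)) : ℝ) : ℂ)) =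
      fun x : ℝ => (((-1 / (√2 * σ)) ^ m * physHermite m (x / (√2 * σ)) *
        Real.exp (-x ^ 2 / (2 * σ ^ 2)) : ℝ) : ℂ) := by
  induction m with
  | zero => simp [physHermite]
  | succ m ih =>
    ext x
    rw [iteratedDeriv_succ, ih]
    apply HasDerivAt.deriv
    apply HasDerivAt.ofReal_comp
    have h₁ := (hasDerivAt_physHermite m (x / (√2 * σ))).comp x
      ((hasDerivAt_id x).div_const (√2 * σ))
    have h₂ := ((((hasDerivAt_id x).pow 2).neg).div_const (2 * σ ^ 2)).exp
    have h := (h₁.const_mul ((-1 / (√2 * σ)) ^ m)).mul h₂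
    refine h.congr_deriv ?_
    have h2 : √2 ^ 2 = 2 := Real.sq_sqrt (by norm_num)
    have hx : x / σ ^ 2 = 2 * (x / (√2 * σ)) * (1 / (√2 * σ)) := by
      field_simp
      rw [h2]
    have he : (-(2 * x) / (2 * σ ^ 2)) = -(x / σ ^ 2) := by field_simp
    simp [Function.comp]
    rw [physHermite_succ, he, hx]
    ring

lemma integrable_pow_mul_gaussian {a : ℝ} (ha : 0 < a) (n : ℕ) :
    Integrable fun x : ℝ => x ^ n * Real.exp (-a * x ^ 2) := by
  have h := integrable_rpow_mul_exp_neg_mul_sq ha (s := n) (by linarith [n.cast_nonneg (α := ℝ)])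
  simpa using h

lemma fourier_gaussian_scaled {σ : ℝ} (hσ : 0 < σ) :
    𝓕 (fun ξ : ℝ => ((Real.exp (-(2 * π ^ 2 * σ ^ 2) * ξ ^ 2) : ℝ) : ℂ)) =
      fun x : ℝ => ((1 / (σ * √(2 * π)) : ℝ) : ℂ) *
        ((Real.exp (-x ^ 2 / (2 * σ ^ 2)) : ℝ) : ℂ) := by
  have hpos : 0 < 2 * π * σ ^ 2 := by positivity
  have h := fourier_gaussian_pi (b := ((2 * π * σ ^ 2 : ℝ) : ℂ)) 
    (by rwa [Complex.ofReal_re])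
  convert h using 1
  · congr 1
    ext ξ
    push_cast
    ring_nf
  · ext x
    have hs : ((2 * π * σ ^ 2 : ℝ) : ℂ) ^ (1 / 2 : ℂ) = ((σ * √(2 * π) : ℝ) : ℂ) := by
      have : (1 / 2 : ℂ) = ((1 / 2 : ℝ) : ℂ) := by norm_num
      rw [this, ← Complex.ofReal_cpow hpos.le, ← Real.sqrt_eq_rpow,
        Real.sqrt_mul (by positivity), Real.sqrt_sq hσ.le, mul_comm]
    have hπ := Real.pi_ne_zero
    rw [hs]
    push_cast
    congr 2
    have : (π : ℂ) ≠ 0 := by exact_mod_cast hπ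
    have : (σ : ℂ) ≠ 0 := by exact_mod_cast hσ.ne'
    field_simp

lemma fourier_pow_mul_gaussian {σ : ℝ} (hσ : 0 < σ) (m : ℕ) (x : ℝ) :
    𝓕 (fun ξ : ℝ => (-2 * π * Complex.I * ξ) ^ m •
        ((Real.exp (-(2 * π ^ 2 * σ ^ 2) * ξ ^ 2) : ℝ) : ℂ)) x =
      (((1 / (σ * √(2 * π))) * ((-1 / (√2 * σ)) ^ m * physHermite m (x / (√2 * σ)) *
        Real.exp (-x ^ 2 / (2 * σ ^ 2))) : ℝ) : ℂ) := by
  have ha : 0 < 2 * π ^ 2 * σ ^ 2 := by positivity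
  rw [← Real.iteratedDeriv_fourier (N := ⊤) _ le_top, fourier_gaussian_scaled hσ,
    iteratedDeriv_const_mul_field, iteratedDeriv_gaussian hσ]
  · push_cast; rfl
  · intro n _
    convert! (integrable_pow_mul_gaussian ha n).ofReal (𝕜 := ℂ) using 2 with ξ
    simp

/-- The Fourier symbol of the Hermite DSC kernel. -/
noncomputable def hermiteDSCSymbol (σ : ℝ) (n : ℕ) (ξ : ℝ) : ℝ :=
  Real.exp (-(2 * π ^ 2 * σ ^ 2) * ξ ^ 2) *
    ∑ k ∈ Finset.range (n + 1), (2 * π ^ 2 * σ ^ 2 * ξ ^ 2) ^ k / (k.factorial : ℝ)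

lemma ofReal_hermiteDSCSymbol (σ : ℝ) (n : ℕ) (ξ : ℝ) :
    (hermiteDSCSymbol σ n ξ : ℂ) = ∑ k ∈ Finset.range (n + 1),
      (((-(σ ^ 2 / 2)) ^ k / (k.factorial : ℝ) : ℝ) : ℂ) •
        ((-2 * π * Complex.I * ξ) ^ (2 * k) •
        ((Real.exp (-(2 * π ^ 2 * σ ^ 2) * ξ ^ 2) : ℝ) : ℂ)) := by
  rw [hermiteDSCSymbol, Complex.ofReal_mul, Complex.ofReal_sum, Finset.mul_sum]
  refine Finset.sum_congr rfl fun k _ => ?_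
  have h : (2 * π ^ 2 * σ ^ 2 * ξ ^ 2 : ℂ) = -(σ ^ 2 / 2) * (-2 * π * Complex.I * ξ) ^ 2 := by
    linear_combination (2 * π ^ 2 * σ ^ 2 * ξ ^ 2 : ℂ) * Complex.I_sq
  simp only [smul_eq_mul]
  push_cast
  rw [h, mul_pow, ← pow_mul]
  ring

lemma integrable_symbol_term {σ : ℝ} (hσ : 0 < σ) (m : ℕ) :
    Integrable fun ξ : ℝ => (-2 * π * Complex.I * ξ) ^ m •
        ((Real.exp (-(2 * π ^ 2 * σ ^ 2) * ξ ^ 2) : ℝ) : ℂ) := by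
  have ha : 0 < 2 * π ^ 2 * σ ^ 2 := by positivity
  convert! ((integrable_pow_mul_gaussian ha m).ofReal (𝕜 := ℂ)).const_mul
    ((-2 * π * Complex.I) ^ m) using 2 with ξ
  rw [smul_eq_mul, mul_pow, RCLike.ofReal_mul, RCLike.ofReal_pow, ← mul_assoc]
  rfl

lemma integrable_hermiteDSCSymbol {σ : ℝ} (hσ : 0 < σ) (n : ℕ) :
    Integrable fun ξ : ℝ => (hermiteDSCSymbol σ n ξ : ℂ) := by
  simp only [ofReal_hermiteDSCSymbol]
  exact integrable_finsetSum _ fun k _ => (integrable_symbol_term hσ (2 * k)).smul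
    (((-(σ ^ 2 / 2)) ^ k / (k.factorial : ℝ) : ℝ) : ℂ)

lemma fourier_hermiteDSCSymbol {σ : ℝ} (hσ : 0 < σ) (n : ℕ) (x : ℝ) :
    𝓕 (fun ξ : ℝ => (hermiteDSCSymbol σ n ξ : ℂ)) x = (hermiteDSCKernel σ n x : ℂ) := by
  have hint (k : ℕ) : Integrable fun ξ : ℝ =>
      (((-(σ ^ 2 / 2)) ^ k / (k.factorial : ℝ) : ℝ) : ℂ) •
        ((-2 * π * Complex.I * ξ) ^ (2 * k) •
        ((Real.exp (-(2 * π ^ 2 * σ ^ 2) * ξ ^ 2) : ℝ) : ℂ)) :=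
    (integrable_symbol_term hσ (2 * k)).smul (((-(σ ^ 2 / 2)) ^ k / (k.factorial : ℝ) : ℝ) : ℂ)
  have hF (k : ℕ) := fourier_pow_mul_gaussian hσ (2 * k) x
  simp only [Real.fourier_eq] at hF
  simp only [ofReal_hermiteDSCSymbol, Real.fourier_eq, Finset.smul_sum]
  rw [integral_finsetSum _ fun k _ => (Real.fourierIntegral_convergent_iff x).2 (hint k),
    hermiteDSCKernel, Finset.mul_sum, Complex.ofReal_sum]
  refine Finset.sum_congr rfl fun k _ => ?_
  simp only [smul_comm _ (((-(σ ^ 2 / 2)) ^ k / (k.factorial : ℝ) : ℝ) : ℂ)]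
  rw [integral_smul, hF, smul_eq_mul, ← Complex.ofReal_mul]
  congr 1
  have h : (-(1 / 4) : ℝ) ^ k = (-(σ ^ 2 / 2)) ^ k * (-1 / (√2 * σ)) ^ (2 * k) := by
    rw [pow_mul, ← mul_pow, div_pow, mul_pow √2, Real.sq_sqrt (by norm_num)]
    congr 1
    field_simp
    norm_num
  rw [h]
  ring

lemma hermiteDSCSymbol_nonneg (σ : ℝ) (n : ℕ) (ξ : ℝ) : 0 ≤ hermiteDSCSymbol σ n ξ := by
  unfold hermiteDSCSymbol
  positivity

lemma hermiteDSCSymbol_le_one (σ : ℝ) (n : ℕ) (ξ : ℝ) : hermiteDSCSymbol σ n ξ ≤ 1 := by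
  unfold hermiteDSCSymbol
  rw [neg_mul, Real.exp_neg, inv_mul_le_one₀ (Real.exp_pos _)]
  exact Real.sum_le_exp_of_nonneg (by positivity) _

lemma tendsto_hermiteDSCSymbol (σ ξ : ℝ) :
    Tendsto (fun n => hermiteDSCSymbol σ n ξ) atTop (nhds 1) := by
  have h := (NormedSpace.expSeries_div_hasSum_exp
    (2 * π ^ 2 * σ ^ 2 * ξ ^ 2)).tendsto_sum_nat
  rw [← Real.exp_eq_exp_ℝ] at h
  have h' := ((tendsto_add_atTop_iff_nat 1).2 h).const_mul
    (Real.exp (-(2 * π ^ 2 * σ ^ 2) * ξ ^ 2))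
  rwa [← Real.exp_add, neg_mul, neg_add_cancel, Real.exp_zero, ← neg_mul] at h'

/-- The Hermite DSC kernel recovers the Dirac delta distribution as the
expansion order `n → ∞`. -/
theorem hermiteDSCKernel_tendsto_delta (σ : ℝ) (hσ : 0 < σ)
    (f : SchwartzMap ℝ ℝ) :
    Filter.Tendsto (fun n : ℕ => ∫ x : ℝ, hermiteDSCKernel σ n x * f x)
      Filter.atTop (nhds (f 0)) := by
  let g : SchwartzMap ℝ ℂ := f.postcompCLM Complex.ofRealCLM
  have hg (x : ℝ) : g x = (f x : ℂ) := rfl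
  have hg0 : ∫ ξ, (𝓕 g) ξ = (f 0 : ℂ) := by
    have h : (𝓕⁻ (𝓕 g)) 0 = g 0 := by rw [FourierTransform.fourierInv_fourier_eq g]
    rw [SchwartzMap.fourierInv_coe, Real.fourierInv_eq] at h
    simpa [hg] using h
  have key (n : ℕ) : ((∫ x : ℝ, hermiteDSCKernel σ n x * f x : ℝ) : ℂ) =
      ∫ ξ : ℝ, (hermiteDSCSymbol σ n ξ : ℂ) * (𝓕 g) ξ := by
    have h := VectorFourier.integral_bilin_fourierIntegral_eq_flip (ContinuousLinearMap.mul ℂ ℂ)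
      (L := innerₗ ℝ) (μ := volume) (ν := volume) Real.continuous_fourierChar continuous_inner
      (integrable_hermiteDSCSymbol hσ n) g.integrable
    simp only [flip_innerₗ] at h
    rw [← integral_complex_ofReal]
    convert! h using 3 with x
    push_cast
    rw [← fourier_hermiteDSCSymbol hσ]
    rfl
  have hlim : Tendsto (fun n : ℕ => ∫ ξ : ℝ, (hermiteDSCSymbol σ n ξ : ℂ) * (𝓕 g) ξ)
      atTop (nhds (∫ ξ, (𝓕 g) ξ)) := by
    refine tendsto_integral_of_dominated_convergence (fun ξ => ‖(𝓕 g) ξ‖) (fun n =>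
      (integrable_hermiteDSCSymbol hσ n).aestronglyMeasurable.mul
        (𝓕 g).integrable.aestronglyMeasurable) (𝓕 g).integrable.norm (fun n => ?_) ?_
    · refine ae_of_all _ fun ξ => ?_
      rw [norm_mul, Complex.norm_of_nonneg (hermiteDSCSymbol_nonneg σ n ξ)]
      exact mul_le_of_le_one_left (norm_nonneg _) (hermiteDSCSymbol_le_one σ n ξ)
    · refine ae_of_all _ fun ξ => ?_
      simpa using ((Complex.continuous_ofReal.tendsto 1).comp
        (tendsto_hermiteDSCSymbol σ ξ)).mul_const ((𝓕 g) ξ)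
  rw [hg0] at hlim
  simp only [← key] at hlim
  simpa [Function.comp_def] using (Complex.continuous_re.tendsto _).comp hlim
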